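/- For any n ≥ 3, any 4-cap-free and n-cup-free configuration of size C(n-1,2)+2 contains a pair of interweaved laced (n-1)-cups. -/

import Mathlib

variable {α : Type*} [LinearOrder α]

/-- Every consecutive triple of the list satisfies `f`. -/
def Triples (f : α → α → α → Prop) : List α → Prop
  | x :: y :: z :: l => f x y z ∧ Triples f (y :: z :: l)
  | _ => True

/-- `l` is a cup in the configuration `(S, cup)`: a nonempty increasing list of
vertices of `S` all of whose consecutive triples are colored cup. -/
def IsCupIn (S : Finset α) (cup : α → α → α → Prop) (l : List α) : Prop :=
  l ≠ [] ∧ l.Chain' (· < ·) ∧ (∀ x ∈ l, x ∈ S) ∧ Triples cup l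

/-- `l` is a cap in the configuration `(S, cup)`. -/
def IsCapIn (S : Finset α) (cup : α → α → α → Prop) (l : List α) : Prop :=
  l ≠ [] ∧ l.Chain' (· < ·) ∧ (∀ x ∈ l, x ∈ S) ∧ Triples (fun x y z => ¬ cup x y z) l

/-- The configuration has no cap with `a` (or more) vertices. -/
def CapFree (S : Finset α) (cup : α → α → α → Prop) (a : ℕ) : Prop :=
  ∀ l : List α, IsCapIn S cup l → l.length < a

/-- The configuration has no cup with `b` (or more) vertices. -/
def CupFree (S : Finset α) (cup : α → α → α → Prop) (b : ℕ) : Prop :=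
  ∀ l : List α, IsCupIn S cup l → l.length < b

def StartsAt (l : List α) (p : α) : Prop := l.head? = some p

def EndsAt (l : List α) (p : α) : Prop := l.getLast? = some p

/-- A weak `(a, b)`-gon: an `a`-cap and a `b`-cup sharing both endpoints. -/
def HasWeakGon (S : Finset α) (cup : α → α → α → Prop) (a b : ℕ) : Prop :=
  ∃ (A U : List α) (x y : α), IsCapIn S cup A ∧ A.length = a ∧
    IsCupIn S cup U ∧ U.length = b ∧
    StartsAt A x ∧ StartsAt U x ∧ EndsAt A y ∧ EndsAt U y

/-- Two cups from `p` to `r` and from `q` to `s` are interweaved if `p < q ≤ r < s`. -/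
def Interweaved (C₁ C₂ : List α) : Prop :=
  ∃ p r q s, StartsAt C₁ p ∧ EndsAt C₁ r ∧ StartsAt C₂ q ∧ EndsAt C₂ s ∧
    p < q ∧ q ≤ r ∧ r < s

/-- A laced `(n-1)`-cup: an `(n-1)`-cup from `p` to `q` together with a cup ending
at `p` and a cup starting at `q` whose sizes sum to `n - 1`. -/
def IsLacedCup (S : Finset α) (cup : α → α → α → Prop) (n : ℕ) (C : List α) : Prop :=
  IsCupIn S cup C ∧ C.length = n - 1 ∧
  ∃ p q Cp Cq, StartsAt C p ∧ EndsAt C q ∧ IsCupIn S cup Cp ∧ IsCupIn S cup Cq ∧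
    EndsAt Cp p ∧ StartsAt Cq q ∧ Cp.length + Cq.length = n - 1

/-- A slope labeling of an `a`-cap-free configuration: labels in `{1, …, a-2}`
such that `s x y ≤ s y z` forces `x y z` to be a cup. -/
def IsSlopeLabeling (S : Finset α) (cup : α → α → α → Prop) (a : ℕ) (s : α → α → ℕ) : Prop :=
  (∀ x ∈ S, ∀ y ∈ S, x < y → 1 ≤ s x y ∧ s x y ≤ a - 2) ∧
  (∀ x ∈ S, ∀ y ∈ S, ∀ z ∈ S, x < y → y < z → s x y ≤ s y z → cup x y z)

/-- `α_i(p)`: maximum length of a cup ending at `p` with last edge of label `≤ i`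
(`1` if there is no such cup). -/
noncomputable def alphaStat (S : Finset α) (cup : α → α → α → Prop) (s : α → α → ℕ)
    (i : ℕ) (p : α) : ℕ :=
  max 1 (sSup {k | ∃ (l : List α) (x : α), IsCupIn S cup l ∧ EndsAt l p ∧
    l.length = k ∧ l.dropLast.getLast? = some x ∧ s x p ≤ i})

/-- `β(p)`: maximum length of a cup ending at `p` (`1` if there is none). -/
noncomputable def betaStat (S : Finset α) (cup : α → α → α → Prop) (p : α) : ℕ :=
  max 1 (sSup {k | ∃ l : List α, IsCupIn S cup l ∧ EndsAt l p ∧ l.length = k})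

/-- The cup coloring of the mirror reflection. -/
def opCup (cup : α → α → α → Prop) : αᵒᵈ → αᵒᵈ → αᵒᵈ → Prop :=
  fun x y z => cup (OrderDual.ofDual z) (OrderDual.ofDual y) (OrderDual.ofDual x)

/-- The vertex set of the mirror reflection. -/
def opSet (S : Finset α) : Finset αᵒᵈ := S.map OrderDual.toDual.toEmbedding

/-- The mirror reflection of a cap/cup. -/
def opList (l : List α) : List αᵒᵈ := (l.map OrderDual.toDual).reverse

/-- `LCup lt one S k x y`: a path of `k` vertices of `S` from `x` to `y` whose edge labels
are first all `one`, then all not `one`. -/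
inductive LCup {β : Type*} (lt one : β → β → Prop) (S : Finset β) : ℕ → β → β → Prop
  | single (x : β) (hx : x ∈ S) : LCup lt one S 1 x x
  | pre {k : ℕ} {x y z : β} (hx : x ∈ S) (h : lt x y) (ho : one x y)
      (c : LCup lt one S k y z) : LCup lt one S (k + 1) x z
  | app {k : ℕ} {x y z : β} (c : LCup lt one S k x y) (hz : z ∈ S) (h : lt y z)
      (ho : ¬ one y z) : LCup lt one S (k + 1) x z

/-- Strict total order as a plain hypothesis. -/
def STO {β : Type*} (lt : β → β → Prop) : Prop :=
  (∀ x, ¬ lt x x) ∧ (∀ x y z, lt x y → lt y z → lt x z) ∧ (∀ x y, lt x y ∨ x = y ∨ lt y x)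

/-- Laced path of `M` vertices from `p` to `q`. -/
def LLaced {β : Type*} (lt one : β → β → Prop) (S : Finset β) (M : ℕ) (p q : β) : Prop :=
  LCup lt one S M p q ∧ ∃ i j a b, M ≤ i + j ∧ LCup lt one S i a p ∧ LCup lt one S j q b

/-- A pair of interweaved laced paths. -/
def LGood {β : Type*} (lt one : β → β → Prop) (S : Finset β) (M : ℕ) : Prop :=
  ∃ p₁ p₂ q₁ q₂, lt p₁ p₂ ∧ (lt p₂ q₁ ∨ p₂ = q₁) ∧ lt q₁ q₂ ∧
    LLaced lt one S M p₁ q₁ ∧ LLaced lt one S M p₂ q₂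

/-- The exceptional outcome of the inductive step. -/
def LSpecial {β : Type*} (lt one : β → β → Prop) (S : Finset β) (M : ℕ) (r : β) : Prop :=
  ∃ t p₁ q₁ q₂ a, LLaced lt one S M t q₁ ∧ lt t p₁ ∧ lt p₁ r ∧ (lt r q₁ ∨ r = q₁) ∧ lt q₁ q₂ ∧
    ¬ one p₁ r ∧ LCup lt one S (M - 1) r q₂ ∧ LCup lt one S (M - 1) p₁ q₁ ∧ LCup lt one S M a r

section labels
variable {β : Type*} {lt one : β → β → Prop} {S : Finset β}

lemma LCup.left_mem {k : ℕ} {x y : β} (c : LCup lt one S k x y) : x ∈ S := by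
  induction c <;> assumption

lemma LCup.right_mem {k : ℕ} {x y : β} (c : LCup lt one S k x y) : y ∈ S := by
  induction c <;> assumption

lemma LCup.pos {k : ℕ} {x y : β} (c : LCup lt one S k x y) : 1 ≤ k := by
  induction c <;> omega

lemma LCup.dual {k : ℕ} {x y : β} (c : LCup lt one S k x y) :
    LCup (fun x y => lt y x) (fun x y => ¬ one y x) S k y x := by
  induction c with
  | single x hx => exact .single x hx
  | pre hx h ho c ih => exact .app ih hx h (by simpa using ho)
  | app c hz h ho ih => exact .pre hz h ho ih

lemma LCup.undual {k : ℕ} {x y : β}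
    (c : LCup (fun x y => lt y x) (fun x y => ¬ one y x) S k y x) : LCup lt one S k x y := by
  simpa using c.dual

lemma LCup.mono {S' : Finset β} (h : S' ⊆ S) {k : ℕ} {x y : β} (c : LCup lt one S' k x y) :
    LCup lt one S k x y := by
  induction c with
  | single x hx => exact .single x (h hx)
  | pre hx hl ho c ih => exact .pre (h hx) hl ho ih
  | app c hz hl ho ih => exact .app ih (h hz) hl ho

lemma STO.dual (h : STO lt) : STO (fun x y => lt y x) :=
  ⟨h.1, fun x y z a b => h.2.1 z y x b a, fun x y => by
    rcases h.2.2 x y with a | a | a <;> simp [a]⟩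

/-- Remove the last vertex. -/
lemma LCup.dropLast (_hlt : STO lt) {k : ℕ} {x z : β} (c : LCup lt one S k x z) (hk : 2 ≤ k) :
    ∃ y, lt y z ∧ LCup lt one S (k - 1) x y := by
  induction c with
  | single x hx => omega
  | @pre k x y z hx h ho c ih =>
    by_cases h1 : k = 1
    · subst h1
      refine ⟨x, ?_, .single x hx⟩
      generalize hj : 1 = j at c
      cases c with
      | single => exact h
      | pre _ _ _ c => have := c.pos; omega
      | app c => have := c.pos; omega
    · have := c.pos
      obtain ⟨w, hw, cw⟩ := ih (by omega)
      refine ⟨w, hw, ?_⟩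
      have := LCup.pre hx h ho cw
      rwa [show k - 1 + 1 = k + 1 - 1 by omega] at this
  | @app k x y z c hz h ho ih => exact ⟨y, h, by simpa using c⟩

lemma LCup.dropFirst (hlt : STO lt) {k : ℕ} {x z : β} (c : LCup lt one S k x z) (hk : 2 ≤ k) :
    ∃ y, lt x y ∧ LCup lt one S (k - 1) y z := by
  obtain ⟨y, hy, d⟩ := c.dual.dropLast hlt.dual hk
  exact ⟨y, hy, d.undual⟩

lemma LCup.le (hlt : STO lt) {k : ℕ} {x z : β} (c : LCup lt one S k x z) : lt x z ∨ x = z := by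
  induction c with
  | single x hx => exact .inr rfl
  | pre hx h ho c ih =>
    rcases ih with ih | ih
    · exact .inl (hlt.2.1 _ _ _ h ih)
    · exact .inl (ih ▸ h)
  | app c hz h ho ih =>
    rcases ih with ih | ih
    · exact .inl (hlt.2.1 _ _ _ ih h)
    · exact .inl (ih ▸ h)

lemma LCup.slt (hlt : STO lt) {k : ℕ} {x z : β} (c : LCup lt one S k x z) (hk : 2 ≤ k) :
    lt x z := by
  obtain ⟨y, hy, d⟩ := c.dropLast hlt hk
  rcases d.le hlt with h | h
  · exact hlt.2.1 _ _ _ h hy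
  · exact h ▸ hy

lemma LCup.truncRight (hlt : STO lt) {k j : ℕ} {x z : β} (c : LCup lt one S k x z)
    (hj : 1 ≤ j) (hk : j ≤ k) : ∃ y, LCup lt one S j x y := by
  induction k generalizing z with
  | zero => omega
  | succ k ih =>
    by_cases h : j = k + 1
    · exact ⟨z, h ▸ c⟩
    · obtain ⟨y, _, d⟩ := c.dropLast hlt (by omega)
      exact ih d (by omega)

lemma LCup.truncLeft (hlt : STO lt) {k j : ℕ} {x z : β} (c : LCup lt one S k x z)
    (hj : 1 ≤ j) (hk : j ≤ k) : ∃ y, LCup lt one S j y z := by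
  obtain ⟨y, d⟩ := c.dual.truncRight hlt.dual hj hk
  exact ⟨y, d.undual⟩

lemma LLaced.undual {M : ℕ} {p q : β}
    (h : LLaced (fun x y => lt y x) (fun x y => ¬ one y x) S M q p) : LLaced lt one S M p q := by
  obtain ⟨c, i, j, a, b, hij, ca, cb⟩ := h
  exact ⟨c.undual, j, i, b, a, by omega, cb.undual, ca.undual⟩

lemma LGood.undual {M : ℕ} (h : LGood (fun x y => lt y x) (fun x y => ¬ one y x) S M) :
    LGood lt one S M := by
  obtain ⟨p₁, p₂, q₁, q₂, h1, h2, h3, l1, l2⟩ := h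
  exact ⟨q₂, q₁, p₂, p₁, h3, h2.imp id Eq.symm, h1, l2.undual, l1.undual⟩

/-- A vertex both starting and ending a maximal path. -/
lemma good_of_both (hlt : STO lt) {M : ℕ} (hM : 2 ≤ M) {a x b : β}
    (c : LCup lt one S M a x) (d : LCup lt one S M x b) : LGood lt one S M :=
  ⟨a, x, x, b, c.slt hlt hM, .inr rfl, d.slt hlt hM,
    ⟨c, 1, M, a, b, by omega, .single _ c.left_mem, d⟩,
    ⟨d, M, 1, a, b, by omega, c, .single _ d.right_mem⟩⟩

/-- The exceptional case, when the label of `s r` is `one`. -/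
lemma good_of_special (hlt : STO lt) {M : ℕ} (hM : 3 ≤ M)
    (hfree : ∀ x y, ¬ LCup lt one S (M + 1) x y) {r s c e : β} (hr : LSpecial lt one S M r)
    (hs : LCup lt one S M s e) (hs' : LCup lt one S (M - 1) c s) (hsr : lt s r) (ho : one s r) :
    LGood lt one S M := by
  obtain ⟨t, p₁, q₁, q₂, a, lt1, htp, hpr, hrq, hqq, hpo, cr, cp, ca⟩ := hr
  have hM1 : M - 1 + 1 = M := by omega
  have cs : LCup lt one S M s q₂ := hM1 ▸ LCup.pre hs.left_mem hsr ho cr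
  have ls : LLaced lt one S M s q₂ :=
    ⟨cs, M - 1, 1, c, q₂, by omega, hs', .single _ cs.right_mem⟩
  have hsq : lt s q₁ := by
    rcases hrq with h | h
    · exact hlt.2.1 _ _ _ hsr h
    · exact h ▸ hsr
  rcases hlt.2.2 t s with h | h | h
  · exact ⟨t, s, q₁, q₂, h, .inl hsq, hqq, lt1, ls⟩
  · subst h
    obtain ⟨w, hw, cw⟩ := hs'.dropLast hlt (by omega)
    have hwp := hlt.2.1 _ _ _ hw htp
    by_cases hwo : one w p₁
    · have cwq : LCup lt one S M w q₁ := hM1 ▸ LCup.pre cw.right_mem hwp hwo cp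
      have hq : one q₁ q₂ := by
        by_contra hq
        exact hfree _ _ (LCup.app lt1.1 cs.right_mem hqq hq)
      refine ⟨w, t, q₁, q₂, hw, .inl hsq, hqq, ⟨cwq, M - 1 - 1, 2, c, q₂, by omega, cw, ?_⟩, ls⟩
      exact LCup.pre cwq.right_mem hqq hq (.single _ cs.right_mem)
    · have c1 := LCup.app cw cp.left_mem hwp hwo
      have c2 := LCup.app c1 cr.left_mem hpr hpo
      rw [show M - 1 - 1 + 1 + 1 = M by omega] at c2
      refine ⟨c, t, r, q₂, ?_, .inl hsr, ?_, ⟨c2, 1, M - 1, c, q₂, by omega,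
        .single _ c2.left_mem, cr⟩, ls⟩
      · rcases cw.le hlt with h | h
        · exact hlt.2.1 _ _ _ h hw
        · exact h ▸ hw
      · exact cr.slt hlt (by omega)
  · have hno : ¬ one s t := fun ho' => hfree _ _ (LCup.pre hs.left_mem h ho' lt1.1)
    have := LCup.app hs' lt1.1.left_mem h hno
    rw [hM1] at this
    exact good_of_both hlt (by omega) this lt1.1

open Classical in
/-- The inductive step. -/
lemma step (hlt : STO lt) {M : ℕ} (hM : 3 ≤ M)
    (hfree : ∀ x y, ¬ LCup lt one S (M + 1) x y) (hcard : M.choose 2 + 2 ≤ S.card)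
    (ih : ∀ S' : Finset β, (∀ x y, ¬ LCup lt one S' (M - 1 + 1) x y) →
      (M - 1).choose 2 + 2 ≤ S'.card → LGood lt one S' (M - 1)) :
    LGood lt one S M ∨ ∃ r, LSpecial lt one S M r := by
  by_cases hPQ : ∃ a x b, LCup lt one S M a x ∧ LCup lt one S M x b
  · obtain ⟨a, x, b, c, d⟩ := hPQ
    exact .inl (good_of_both hlt (by omega) c d)
  push Not at hPQ
  have hM1 : M - 1 + 1 = M := by omega
  -- the longest path ending at a vertex
  let f : β → ℕ := fun x => Nat.findGreatest (fun k => ∃ a, LCup lt one S k a x) M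
  have hle : ∀ {k a x}, LCup lt one S k a x → k ≤ M := by
    intro k a x c
    by_contra hk
    obtain ⟨y, d⟩ := c.truncRight hlt (j := M + 1) (by omega) (by omega)
    exact hfree _ _ d
  have hf1 : ∀ {k a x}, LCup lt one S k a x → k ≤ f x := fun {k a x} c =>
    Nat.le_findGreatest (P := fun k => ∃ a, LCup lt one S k a x) (hle c) ⟨a, c⟩
  have hf2 : ∀ x ∈ S, ∃ a, LCup lt one S (f x) a x := fun x hx =>
    Nat.findGreatest_spec (P := fun k => ∃ a, LCup lt one S k a x) (m := 1) (by omega)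
      ⟨x, .single x hx⟩
  have hfM : ∀ x, f x ≤ M := fun x => Nat.findGreatest_le M
  have hfpos : ∀ x ∈ S, 1 ≤ f x := fun x hx => hf1 (.single x hx)
  have hflt : ∀ x ∈ S, ∀ y ∈ S, lt x y → ¬ one x y → f x + 1 ≤ f y := by
    intro x hx y hy h ho
    obtain ⟨a, c⟩ := hf2 x hx
    exact hf1 (LCup.app c hy h ho)
  have hfeq : ∀ x ∈ S, ∀ y ∈ S, lt x y → f x = f y → one x y := by
    intro x hx y hy h he
    by_contra ho
    have := hflt x hx y hy h ho
    omega
  let X := S.filter (fun x => f x ≤ M - 1 ∧ ∀ y ∈ S, f y = f x → ¬ lt y x)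
  have hX : X.card ≤ M - 1 := by
    have : X.card ≤ (Finset.Icc 1 (M - 1)).card := by
      refine Finset.card_le_card_of_injOn f ?_ ?_
      · intro x hx
        have hx := Finset.mem_filter.1 hx
        exact Finset.mem_coe.2 (Finset.mem_Icc.2 ⟨hfpos x hx.1, hx.2.1⟩)
      · intro x hx y hy he
        have hx := Finset.mem_filter.1 hx
        have hy := Finset.mem_filter.1 hy
        rcases hlt.2.2 x y with h | h | h
        · exact (hy.2.2 x hx.1 he h).elim
        · exact h
        · exact (hx.2.2 y hy.1 he.symm h).elim
    simpa using this
  have hsub : S \ X ⊆ S := Finset.sdiff_subset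
  -- predecessor
  have hpred : ∀ x ∈ S \ X, f x ≤ M - 1 → ∃ t ∈ S, f t = f x ∧ lt t x ∧ one t x := by
    intro x hx hfx
    rw [Finset.mem_sdiff] at hx
    obtain ⟨hx, hx'⟩ := hx
    have : ∃ t ∈ S, f t = f x ∧ lt t x := by
      by_contra hcon
      push Not at hcon
      exact hx' (Finset.mem_filter.2 ⟨hx, hfx, hcon⟩)
    obtain ⟨t, ht, h1, h2⟩ := this
    exact ⟨t, ht, h1, h2, hfeq t ht x hx h2 h1⟩
  have hQ : ∀ x ∈ S, ¬ f x ≤ M - 1 → ∃ a, LCup lt one S M a x := by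
    intro x hx h
    have := hfM x
    have h3 := hf2 x hx
    rwa [show f x = M by omega] at h3
  have hfree' : ∀ x y, ¬ LCup lt one (S \ X) (M - 1 + 1) x y := by
    intro x y c
    rw [hM1] at c
    have cS := c.mono hsub
    by_cases h : f x ≤ M - 1
    · obtain ⟨t, ht, _, h2, h3⟩ := hpred x c.left_mem h
      exact hfree _ _ (LCup.pre ht h2 h3 cS)
    · obtain ⟨a, d⟩ := hQ x cS.left_mem h
      exact hPQ a x y d cS
  have hcard' : (M - 1).choose 2 + 2 ≤ (S \ X).card := by
    have h1 := Finset.le_card_sdiff X S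
    have h2 : M.choose 2 = (M - 1).choose 1 + (M - 1).choose 2 := by
      conv_lhs => rw [← hM1]
      exact Nat.choose_succ_succ _ _
    rw [Nat.choose_one_right] at h2
    omega
  obtain ⟨p₁, p₂, q₁, q₂, hp, hpq, hq, ⟨c1, i1, j1, a1, b1, hij1, d1, e1⟩,
    ⟨c2, i2, j2, a2, b2, hij2, d2, e2⟩⟩ := ih _ hfree' hcard'
  -- no vertex of `Q` before a start
  have hnoQ : ∀ {p q x a}, LCup lt one S (M - 1) p q → LCup lt one S M a x → ¬ lt x p := by
    intro p q x a c d h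
    by_cases ho : one x p
    · exact hPQ _ _ _ d (hM1 ▸ LCup.pre d.right_mem h ho c)
    · exact hfree _ _ (LCup.app d c.left_mem h ho)
  -- extension of a laced path
  have hext : ∀ {p q i j a b}, LCup lt one (S \ X) (M - 1) p q → M - 1 ≤ i + j →
      LCup lt one (S \ X) i a p → LCup lt one (S \ X) j q b → f p ≤ M - 1 →
      ∃ t, f t = f p ∧ lt t p ∧ LLaced lt one S M t q := by
    intro p q i j a b c hij d e hfp
    obtain ⟨t, ht, h1, h2, h3⟩ := hpred p c.left_mem hfp
    obtain ⟨a', ca'⟩ := hf2 t ht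
    have hi : i + 1 ≤ f p := by
      by_cases hfa : f a ≤ M - 1
      · obtain ⟨u, hu, _, h5, h6⟩ := hpred a d.left_mem hfa
        exact hf1 (LCup.pre hu h5 h6 (d.mono hsub))
      · exfalso
        obtain ⟨g, cg⟩ := hQ a (hsub d.left_mem) hfa
        rcases d.le hlt with h | h
        · exact hnoQ (c.mono hsub) cg h
        · exact hfa (h ▸ hfp)
    exact ⟨t, h1, h2, hM1 ▸ LCup.pre ht h2 h3 (c.mono hsub), f t, j, a', b, by omega, ca',
      e.mono hsub⟩
  have hf_p1 : f p₁ ≤ M - 1 := by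
    by_contra h
    obtain ⟨g, cg⟩ := hQ p₁ (hsub c1.left_mem) h
    exact hnoQ (c2.mono hsub) cg hp
  have hno : ¬ one p₁ p₂ := fun ho => hfree' _ _ (LCup.pre c1.left_mem hp ho c2)
  obtain ⟨t₁, ht1, htp1, l1⟩ := hext c1 hij1 d1 e1 hf_p1
  by_cases hf_p2 : f p₂ ≤ M - 1
  · left
    obtain ⟨t₂, ht2, htp2, l2⟩ := hext c2 hij2 d2 e2 hf_p2
    have hff := hflt p₁ (hsub c1.left_mem) p₂ (hsub c2.left_mem) hp hno
    refine ⟨t₁, t₂, q₁, q₂, ?_, .inl ?_, hq, l1, l2⟩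
    · rcases hlt.2.2 t₁ t₂ with h | h | h
      · exact h
      · subst h; omega
      · exfalso
        have ho : ¬ one t₂ t₁ := fun ho => hfree _ _ (LCup.pre l2.1.left_mem h ho l1.1)
        have := hflt t₂ l2.1.left_mem t₁ l1.1.left_mem h ho
        omega
    · rcases hpq with h | h
      · exact hlt.2.1 _ _ _ htp2 h
      · exact h ▸ htp2
  · right
    obtain ⟨g, cg⟩ := hQ p₂ (hsub c2.left_mem) hf_p2
    exact ⟨p₂, t₁, p₁, q₁, q₂, g, l1, htp1, hp, hpq, hq, hno, c2.mono hsub, c1.mono hsub, cg⟩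

end labels

lemma exists_three {β : Type*} {lt : β → β → Prop} (hlt : STO lt) {S : Finset β}
    (h : 3 ≤ S.card) : ∃ x ∈ S, ∃ y ∈ S, ∃ z ∈ S, lt x y ∧ lt y z := by
  obtain ⟨a, b, c, ha, hb, hc, hab, hac, hbc⟩ := Finset.two_lt_card_iff.1 h
  rcases hlt.2.2 a b with h1 | h1 | h1 <;> rcases hlt.2.2 b c with h2 | h2 | h2 <;>
    rcases hlt.2.2 a c with h3 | h3 | h3 <;> first
    | exact absurd h1 hab
    | exact absurd h2 hbc
    | exact absurd h3 hac
    | exact ⟨a, ha, b, hb, c, hc, h1, h2⟩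
    | exact ⟨a, ha, c, hc, b, hb, h3, h2⟩
    | exact ⟨b, hb, a, ha, c, hc, h1, h3⟩
    | exact ⟨b, hb, c, hc, a, ha, h2, h3⟩
    | exact ⟨c, hc, a, ha, b, hb, h3, h1⟩
    | exact ⟨c, hc, b, hb, a, ha, h2, h1⟩

theorem label_main (M : ℕ) (hM : 2 ≤ M) {β : Type*} (lt one : β → β → Prop) (hlt : STO lt)
    (S : Finset β) (hfree : ∀ x y, ¬ LCup lt one S (M + 1) x y)
    (hcard : M.choose 2 + 2 ≤ S.card) : LGood lt one S M := by
  induction M, hM using Nat.le_induction generalizing lt one S with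
  | base =>
    obtain ⟨x, hx, y, hy, z, hz, hxy, hyz⟩ := exists_three hlt (S := S) (by simpa using hcard)
    have two : ∀ {u v}, u ∈ S → v ∈ S → lt u v → LLaced lt one S 2 u v := by
      intro u v hu hv h
      refine ⟨?_, 1, 1, u, v, le_rfl, .single _ hu, .single _ hv⟩
      by_cases ho : one u v
      · exact LCup.pre hu h ho (.single _ hv)
      · exact LCup.app (.single _ hu) hv h ho
    exact ⟨x, y, y, z, hxy, .inr rfl, hyz, two hx hy hxy, two hy hz hyz⟩
  | succ M hM ih =>
    have key := step hlt (M := M + 1) (by omega) hfree hcard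
      (fun S' h1 h2 => ih lt one hlt S' h1 h2)
    have hfreed : ∀ x y, ¬ LCup (fun x y => lt y x) (fun x y => ¬ one y x) S (M + 1 + 1) x y :=
      fun x y c => hfree _ _ c.undual
    have keyd := step hlt.dual (M := M + 1) (by omega) hfreed hcard
      (fun S' h1 h2 => ih _ _ hlt.dual S' h1 h2)
    rcases key with g | ⟨r, hr⟩
    · exact g
    rcases keyd with g | ⟨s, hs⟩
    · exact g.undual
    obtain ⟨_, _, _, q₂, ar, _, _, _, _, _, _, r2, _, r1⟩ := id hr
    obtain ⟨_, _, _, q₂', as, _, _, _, _, _, _, s2, _, s1⟩ := id hs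
    by_cases hsr : lt s r
    · by_cases ho : one s r
      · exact good_of_special hlt (by omega) hfree hr s1.undual s2.undual hsr ho
      · exact (good_of_special hlt.dual (by omega) hfreed hs r1.dual r2.dual hsr ho).undual
    · rcases hlt.2.2 s r with h | h | h
      · exact absurd h hsr
      · subst h
        exact good_of_both hlt (by omega) r1 s1.undual
      · exfalso
        by_cases ho : one r s
        · exact hfree _ _ (LCup.pre r1.right_mem h ho s1.undual)
        · exact hfree _ _ (LCup.app r1 s1.right_mem h ho)

/-- Conversion of labelled paths to cups. -/
lemma LCup.toList {S : Finset α} {cup : α → α → α → Prop} {o : α → α → Prop}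
    (h1 : ∀ x ∈ S, ∀ y ∈ S, ∀ z ∈ S, x < y → y < z → o x y → cup x y z)
    (h2 : ∀ x ∈ S, ∀ y ∈ S, ∀ z ∈ S, x < y → y < z → ¬ o y z → cup x y z)
    {k : ℕ} {x y : α} (c : LCup (fun a b => a < b) o S k x y) :
    ∃ l, IsCupIn S cup l ∧ StartsAt l x ∧ EndsAt l y ∧ l.length = k := by
  have tr : ∀ (l : List α) (y z : α), (∀ w ∈ l, w ∈ S) → l.IsChain (· < ·) → y ∈ S → z ∈ S →
      y < z → l.getLast? = some y → (∀ x ∈ S, x < y → cup x y z) → Triples cup l →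
      Triples cup (l ++ [z]) ∧ (l ++ [z]).IsChain (· < ·) := by
    intro l
    induction l with
    | nil => intro y z _ _ _ _ _ h; simp at h
    | cons a l ih =>
      intro y z hl hc hy hz hyz hlast hcup ht
      match l, ih with
      | [], _ =>
        simp at hlast
        subst hlast
        simpa [Triples] using hyz
      | [b], ih =>
        simp at hlast
        subst hlast
        simp at hc
        simp [Triples, hcup a (hl a (by simp)) hc, hc, hyz]
      | b :: d :: l, ih =>
        have := ih y z (fun w hw => hl w (by simp [hw])) (by simp at hc ⊢; exact hc.2) hy hz hyz
          (by simpa using hlast) hcup ht.2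
        refine ⟨⟨ht.1, this.1⟩, ?_⟩
        have h3 := this.2
        simp at hc h3 ⊢
        exact ⟨hc.1, h3⟩
  induction c with
  | single x hx => exact ⟨[x], ⟨by simp, List.isChain_singleton x, by simpa using hx, by simp [Triples]⟩,
      by simp [StartsAt], by simp [EndsAt], rfl⟩
  | @pre k x y z hx h ho c ih =>
    obtain ⟨l, ⟨hne, hc, hm, ht⟩, hs, he, hlen⟩ := ih
    change l.IsChain (· < ·) at hc
    match l, hne with
    | [b], _ =>
      simp [StartsAt] at hs
      subst hs
      refine ⟨[x, b], ⟨by simp, ?_, ?_, by simp [Triples]⟩, by simp [StartsAt],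
        by simpa [EndsAt] using he, by simp at hlen ⊢; omega⟩
      · change List.IsChain _ _
        simpa using h
      simpa [hx] using hm
    | b :: d :: l, _ =>
      simp [StartsAt] at hs
      subst hs
      have hbd : b < d := by simp at hc; exact hc.1
      refine ⟨x :: b :: d :: l, ⟨by simp, ?_, ?_, ⟨?_, ht⟩⟩, by simp [StartsAt],
        by simpa [EndsAt] using he, by simpa using hlen⟩
      · change List.IsChain _ _
        simp at hc ⊢
        exact ⟨h, hc⟩
      · intro w hw
        rcases List.mem_cons.1 hw with rfl | hw
        · exact hx
        · exact hm w hw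
      · exact h1 x hx b (hm b (by simp)) d (hm d (by simp)) h hbd ho
  | @app k x y z c hz h ho ih =>
    obtain ⟨l, ⟨hne, hc, hm, ht⟩, hs, he, hlen⟩ := ih
    change l.IsChain (· < ·) at hc
    have hy := c.right_mem
    have := tr l y z hm hc hy hz h he (fun w hw hwy => h2 w hw y hy z hz hwy h ho) ht
    refine ⟨l ++ [z], ⟨by simp, this.2, ?_, this.1⟩, ?_, by simp [EndsAt], by simpa using hlen⟩
    · intro w hw
      rcases List.mem_append.1 hw with hw | hw
      · exact hm w hw
      · simp at hw; exact hw ▸ hz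
    · unfold StartsAt at hs ⊢
      simp [List.head?_append, hs]

theorem stmt15 (n : ℕ) (hn : 3 ≤ n) (S : Finset α) (cup : α → α → α → Prop)
    (h4 : CapFree S cup 4) (hncf : CupFree S cup n)
    (hcard : S.card = Nat.choose (n - 1) 2 + 2) :
    ∃ C₁ C₂ : List α, IsLacedCup S cup n C₁ ∧ IsLacedCup S cup n C₂ ∧
      Interweaved C₁ C₂ := by
  have hlt : STO (fun a b : α => a < b) :=
    ⟨fun x => lt_irrefl x, fun x y z => lt_trans, fun x y => lt_trichotomy x y⟩
  let o : α → α → Prop := fun y z => ∃ x ∈ S, x < y ∧ ¬ cup x y z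
  have h1 : ∀ x ∈ S, ∀ y ∈ S, ∀ z ∈ S, x < y → y < z → o x y → cup x y z := by
    rintro x hx y hy z hz hxy hyz ⟨w, hw, hwx, hcap⟩
    by_contra hc
    have := h4 [w, x, y, z] ⟨by simp, by change List.IsChain _ _; simp [hwx, hxy, hyz], by simp [hw, hx, hy, hz],
      by simp [Triples, hcap, hc]⟩
    simp at this
  have h2 : ∀ x ∈ S, ∀ y ∈ S, ∀ z ∈ S, x < y → y < z → ¬ o y z → cup x y z := by
    intro x hx y hy z hz hxy hyz ho
    by_contra hc
    exact ho ⟨x, hx, hxy, hc⟩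
  have hfree : ∀ x y, ¬ LCup (fun a b : α => a < b) o S (n - 1 + 1) x y := by
    intro x y c
    obtain ⟨l, hl, _, _, hlen⟩ := c.toList h1 h2
    have := hncf l hl
    omega
  obtain ⟨p₁, p₂, q₁, q₂, hp, hpq, hq, l1, l2⟩ :=
    label_main (n - 1) (by omega) (fun a b : α => a < b) o hlt S hfree hcard.ge
  have conv : ∀ {p q}, LLaced (fun a b : α => a < b) o S (n - 1) p q →
      ∃ C, IsLacedCup S cup n C ∧ StartsAt C p ∧ EndsAt C q := by
    rintro p q ⟨c, i, j, a, b, hij, ca, cb⟩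
    obtain ⟨C, hC, hs, he, hlen⟩ := c.toList h1 h2
    have hi := ca.pos
    obtain ⟨a', ca'⟩ := ca.truncLeft hlt (j := min i (n - 2)) (by omega) (by omega)
    have hj := cb.pos
    obtain ⟨b', cb'⟩ := cb.truncRight hlt (j := n - 1 - min i (n - 2)) (by omega) (by omega)
    obtain ⟨Cp, hCp, _, heP, hlenP⟩ := ca'.toList h1 h2
    obtain ⟨Cq, hCq, hsQ, _, hlenQ⟩ := cb'.toList h1 h2
    exact ⟨C, ⟨hC, hlen, p, q, Cp, Cq, hs, he, hCp, hCq, heP, hsQ, by omega⟩, hs, he⟩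
  obtain ⟨C₁, hC₁, hs₁, he₁⟩ := conv l1
  obtain ⟨C₂, hC₂, hs₂, he₂⟩ := conv l2
  exact ⟨C₁, C₂, hC₁, hC₂, p₁, q₁, p₂, q₂, hs₁, he₁, hs₂, he₂, hp, hpq.elim le_of_lt le_of_eq, hq⟩
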